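/- arXiv:2211.15559 — 5 statements merged into one kernel-verified Lean document; each statement's English description precedes it below -/
import Mathlib

section
/- For every s ≥ 1 and all integers 0 ≤ k, i < 2^s, one has ∏_{l=0}^{s−1} (−1)^{⌊k/2^l⌋·⌊i/2^l⌋} = (−1)^{\vec k·\vec i}; equivalently, Σ_{l=0}^{s−1} ⌊k/2^l⌋·⌊i/2^l⌋ ≡ Σ_{l=0}^{s−1} k_l·i_l (mod 2). -/
/-- Dot product of the length-`s` binary representations of `k` and `i`. -/
def bitDot (s k i : ℕ) : ℕ := ∑ l ∈ Finset.range s, (k / 2 ^ l % 2) * (i / 2 ^ l % 2)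

/-- For all `s ≥ 1` and `0 ≤ k, i < 2^s`,
`∏_{l=0}^{s-1} (-1)^{⌊k/2^l⌋·⌊i/2^l⌋} = (-1)^{k⃗·i⃗}`. -/
theorem prod_floor_signs_eq_bitDot_sign (s k i : ℕ) (hs : 1 ≤ s)
    (hk : k < 2 ^ s) (hi : i < 2 ^ s) :
    (∏ l ∈ Finset.range s, (-1 : ℤ) ^ ((k / 2 ^ l) * (i / 2 ^ l))) =
      (-1 : ℤ) ^ bitDot s k i := by
  rw [Finset.prod_pow_eq_pow_sum, bitDot]
  refine neg_one_pow_congr ?_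
  rw [Nat.even_iff, Nat.even_iff, Finset.sum_nat_mod,
    Finset.sum_nat_mod _ _ fun l => k / 2 ^ l % 2 * (i / 2 ^ l % 2)]
  simp only [← Nat.mul_mod]
end

section
/- Let N ≥ 1, let β_0, β_1 ≥ 0 be reals, and let Y : ℕ^N → [0,1]. For every binary vector \vec f ∈ {0,1}^N define the rescaled gain G̃_{\vec f} = Σ_{(n_0,…,n_{N−1}) ∈ ℕ^N} [Y(n_0,…,n_{N−1}) / (n_0!·…·n_{N−1}!)] · ∏_{i=0}^{N−1} β_{f_i}^{n_i} (this series converges absolutely). Then for every binary vector \vec h ∈ {0,1}^N: Σ_{\vec f ∈ {0,1}^N} (−1)^{|\vec f|} · β_0^{(\vec 1 − \vec h)·\vec f} · β_1^{(\vec 1 − \vec h)·(\vec 1 − \vec f)} · G̃_{\vec f} = Σ_{(n_0,…,n_{N−1}) ∈ ℕ^N} [Y(n_0,…,n_{N−1}) / (n_0!·…·n_{N−1}!)] · ∏_{i=0}^{N−1} ( β_1^{1−h_i}·β_0^{n_i} − β_0^{1−h_i}·β_1^{n_i} ). -/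
theorem summable_prod_pow_div_factorial {ι : Type*} [Fintype ι] (c : ι → ℝ)
    (hc : ∀ i, 0 ≤ c i) :
    Summable fun n : ι → ℕ ↦ ∏ i, c i ^ n i / (n i).factorial := by
  classical
  have hnonneg (n : ι → ℕ) : 0 ≤ ∏ i, c i ^ n i / ((n i).factorial : ℝ) :=
    Finset.prod_nonneg fun i _ ↦ div_nonneg (pow_nonneg (hc i) _) (Nat.cast_nonneg _)
  refine summable_of_sum_le (c := ∏ i, Real.exp (c i)) hnonneg fun u ↦ ?_
  let M := u.sup fun n ↦ Finset.univ.sup n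
  have hsub : u ⊆ Fintype.piFinset fun _ ↦ Finset.range (M + 1) := fun n hn ↦ by
    refine Fintype.mem_piFinset.2 fun i ↦ Finset.mem_range_succ_iff.2 ?_
    exact (Finset.le_sup (f := n) (Finset.mem_univ i)).trans
      (Finset.le_sup (f := fun n : ι → ℕ ↦ Finset.univ.sup n) hn)
  calc ∑ n ∈ u, ∏ i, c i ^ n i / ((n i).factorial : ℝ)
      ≤ ∑ n ∈ Fintype.piFinset fun _ ↦ Finset.range (M + 1),
          ∏ i, c i ^ n i / ((n i).factorial : ℝ) :=
        Finset.sum_le_sum_of_subset_of_nonneg hsub fun n _ _ ↦ hnonneg n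
    _ = ∏ i, ∑ k ∈ Finset.range (M + 1), c i ^ k / (k.factorial : ℝ) :=
        (Finset.prod_univ_sum (fun _ ↦ Finset.range (M + 1))
          fun i k ↦ c i ^ k / (k.factorial : ℝ)).symm
    _ ≤ ∏ i, Real.exp (c i) := by
        gcongr with i
        · exact fun i _ ↦ Finset.sum_nonneg fun k _ ↦
            div_nonneg (pow_nonneg (hc i) _) (Nat.cast_nonneg _)
        · exact Real.sum_le_exp_of_nonneg (hc i) _

theorem summable_yield_mul_prod_pow {ι : Type*} [Fintype ι] (c : ι → ℝ) (hc : ∀ i, 0 ≤ c i)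
    (Y : (ι → ℕ) → ℝ) (hY : ∀ n, Y n ∈ Set.Icc (0 : ℝ) 1) :
    Summable fun n : ι → ℕ ↦ Y n / (∏ i, ((n i).factorial : ℝ)) * ∏ i, c i ^ n i := by
  have heq (n : ι → ℕ) : Y n / (∏ i, ((n i).factorial : ℝ)) * ∏ i, c i ^ n i =
      Y n * ∏ i, c i ^ n i / ((n i).factorial : ℝ) := by
    rw [Finset.prod_div_distrib]
    ring
  have hnonneg (n : ι → ℕ) : 0 ≤ ∏ i, c i ^ n i / ((n i).factorial : ℝ) :=
    Finset.prod_nonneg fun i _ ↦ div_nonneg (pow_nonneg (hc i) _) (Nat.cast_nonneg _)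
  simp only [heq]
  exact (summable_prod_pow_div_factorial c hc).of_nonneg_of_le
    (fun n ↦ mul_nonneg (hY n).1 (hnonneg n))
    fun n ↦ mul_le_of_le_one_left (hnonneg n) (hY n).2

theorem prod_sub_eq_sum_bool {ι R : Type*} [Fintype ι] [DecidableEq ι] [CommRing R]
    (x y : R) (e n : ι → ℕ) :
    ∏ i, (y ^ e i * x ^ n i - x ^ e i * y ^ n i) =
      ∑ f : ι → Bool, (-1) ^ (∑ i, (f i).toNat) * x ^ (∑ i, e i * (f i).toNat) *
        y ^ (∑ i, e i * (1 - (f i).toNat)) * ∏ i, (if f i then y else x) ^ n i := by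
  have hfactor (i : ι) : y ^ e i * x ^ n i - x ^ e i * y ^ n i =
      ∑ b : Bool, (-1) ^ b.toNat * x ^ (e i * b.toNat) * y ^ (e i * (1 - b.toNat)) *
        (if b then y else x) ^ n i := by
    simp
    ring
  simp only [hfactor, Finset.prod_univ_sum, Fintype.piFinset_univ, Finset.prod_mul_distrib,
    Finset.prod_pow_eq_pow_sum]


/-- The combination `B_h` of rescaled gains equals the series with coefficients
`∏_i (β_1^{1-h_i} β_0^{n_i} - β_0^{1-h_i} β_1^{n_i})`. Here a binary vector in
`{0,1}^N` is encoded as `Fin N → Bool` (`true = 1`), and `β_{f_i}` is `b1` if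
`f i = true` and `b0` otherwise. -/
theorem gains_combination_eq_yield_series (N : ℕ) (hN : 1 ≤ N)
    (b0 b1 : ℝ) (hb0 : 0 ≤ b0) (hb1 : 0 ≤ b1)
    (Y : (Fin N → ℕ) → ℝ) (hY : ∀ n, Y n ∈ Set.Icc (0 : ℝ) 1)
    (G : (Fin N → Bool) → ℝ)
    (hG : ∀ f, G f = ∑' n : Fin N → ℕ,
      (Y n / ∏ i, (Nat.factorial (n i) : ℝ)) * ∏ i, (if f i then b1 else b0) ^ (n i))
    (h : Fin N → Bool) :
    (∑ f : Fin N → Bool,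
      (-1 : ℝ) ^ (∑ i, (f i).toNat) *
        b0 ^ (∑ i, (1 - (h i).toNat) * (f i).toNat) *
        b1 ^ (∑ i, (1 - (h i).toNat) * (1 - (f i).toNat)) * G f) =
    ∑' n : Fin N → ℕ, (Y n / ∏ i, (Nat.factorial (n i) : ℝ)) *
      ∏ i, (b1 ^ (1 - (h i).toNat) * b0 ^ (n i) - b0 ^ (1 - (h i).toNat) * b1 ^ (n i)) := by
  have hsum (f : Fin N → Bool) := summable_yield_mul_prod_pow
    (fun i ↦ if f i then b1 else b0) (fun i ↦ by split_ifs <;> assumption) Y hY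
  simp only [hG, ← tsum_mul_left]
  rw [← Summable.tsum_finsetSum fun f _ ↦ (hsum f).mul_left _]
  refine tsum_congr fun n ↦ ?_
  rw [prod_sub_eq_sum_bool b0 b1 (fun i ↦ 1 - (h i).toNat) n, Finset.mul_sum]
  exact Finset.sum_congr rfl fun f _ ↦ mul_left_comm _ _ _
end

section
/- Let β_0, β_1 > 0 be reals, let N ≥ 1, and let \vec h, \vec h' ∈ {0,1}^N be binary vectors with h_i ≤ h'_i for all i; set m = |\vec h| and k = |\vec h'| − m. Let 𝒩 be the set of all (n_0,…,n_{N−1}) ∈ ℕ^N such that n_i ≥ 1 whenever h_i = 1, n_i ≥ 2 whenever h'_i = 1 and h_i = 0, and n_i = 0 whenever h'_i = 0. Then Σ_{(n_0,…,n_{N−1}) ∈ 𝒩} [ ∏_{i : h_i = 1} (β_0^{n_i} − β_1^{n_i})/n_i! ] · [ ∏_{i : h'_i − h_i = 1} (β_0^{n_i − 1} − β_1^{n_i − 1})/n_i! ] = (e^{β_0} − e^{β_1})^m · ( (β_1·e^{β_0} − β_0·e^{β_1} + β_0 − β_1)/(β_0·β_1) )^k. -/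
theorem HasSum.mul_real {ι κ : Type*} {f : ι → ℝ} {g : κ → ℝ} {a b : ℝ}
    (hf : HasSum f a) (hg : HasSum g b) :
    HasSum (fun p : ι × κ => f p.1 * g p.2) (a * b) :=
  hf.mul hg (summable_mul_of_summable_norm (summable_norm_iff.mpr hf.summable)
    (summable_norm_iff.mpr hg.summable))

/-- Finite products of real series: the series over `Fin N → ℕ` with product terms sums to the
product of the sums. -/
theorem hasSum_fin_pi_prod {N : ℕ} {f : Fin N → ℕ → ℝ} {a : Fin N → ℝ}
    (hf : ∀ i, HasSum (f i) (a i)) :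
    HasSum (fun n : Fin N → ℕ => ∏ i, f i (n i)) (∏ i, a i) := by
  induction N with
  | zero => simp
  | succ N ih =>
    have htail := ih fun i => hf i.succ
    have hprod := (hf 0).mul_real htail
    rw [← (Fin.consEquiv fun _ : Fin (N + 1) => ℕ).hasSum_iff, Fin.prod_univ_succ]
    simpa [Function.comp_def, Fin.prod_univ_succ] using hprod

theorem Real.hasSum_pow_div_factorial (b : ℝ) :
    HasSum (fun n : ℕ => b ^ n / (n.factorial : ℝ)) (Real.exp b) := by
  rw [Real.exp_eq_exp_ℝ]
  exact NormedSpace.expSeries_div_hasSum_exp b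

theorem hasSum_pow_sub_pow_div_factorial (b0 b1 : ℝ) :
    HasSum (fun n : ℕ => (b0 ^ n - b1 ^ n) / (n.factorial : ℝ)) (Real.exp b0 - Real.exp b1) := by
  simpa only [sub_div] using
    (Real.hasSum_pow_div_factorial b0).sub (Real.hasSum_pow_div_factorial b1)

theorem hasSum_pow_pred_sub_pow_pred_div_factorial {b0 b1 : ℝ} (hb0 : b0 ≠ 0) (hb1 : b1 ≠ 0) :
    HasSum (fun n : ℕ => (b0 ^ (n - 1) - b1 ^ (n - 1)) / (n.factorial : ℝ))
      ((b1 * Real.exp b0 - b0 * Real.exp b1 + b0 - b1) / (b0 * b1)) := by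
  have key := (((Real.hasSum_pow_div_factorial b0).div_const b0).sub
    ((Real.hasSum_pow_div_factorial b1).div_const b1)).sub
      (hasSum_ite_eq (0 : ℕ) (1 / b0 - 1 / b1))
  have hval : Real.exp b0 / b0 - Real.exp b1 / b1 - (1 / b0 - 1 / b1) =
      (b1 * Real.exp b0 - b0 * Real.exp b1 + b0 - b1) / (b0 * b1) := by
    field_simp
    ring
  rw [← hval]
  refine (congrArg (HasSum · _) (funext fun n => ?_)).mpr key
  cases n with
  | zero => simp
  | succ n =>
    have hn : ((n + 1).factorial : ℝ) ≠ 0 := by positivity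
    simp only [Nat.add_sub_cancel, Nat.add_eq_zero_iff, one_ne_zero, and_false, if_false]
    field_simp
    ring

/-- Factorization of the multi-index series over the set `𝒩` of photon-number tuples
(`n_i ≥ 1` where `h_i = 1`, `n_i ≥ 2` where `h'_i = 1, h_i = 0`, `n_i = 0` where
`h'_i = 0`) into univariate series:
`∑_{n ∈ 𝒩} ∏_{h_i=1} (β_0^{n_i}-β_1^{n_i})/n_i! ∏_{h'_i-h_i=1} (β_0^{n_i-1}-β_1^{n_i-1})/n_i!
 = (e^{β_0}-e^{β_1})^m ((β_1 e^{β_0}-β_0 e^{β_1}+β_0-β_1)/(β_0 β_1))^k`. -/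
theorem multiindex_series_factorization (b0 b1 : ℝ) (hb0 : 0 < b0) (hb1 : 0 < b1)
    (N : ℕ) (hN : 1 ≤ N) (h h' : Fin N → Bool)
    (hle : ∀ i, h i = true → h' i = true) :
    (∑' n : Fin N → ℕ,
      if (∀ i, (h i = true → 1 ≤ n i) ∧ (h' i = true ∧ h i = false → 2 ≤ n i) ∧
            (h' i = false → n i = 0)) then
        (∏ i ∈ Finset.univ.filter fun i => h i = true,
            (b0 ^ (n i) - b1 ^ (n i)) / (Nat.factorial (n i) : ℝ)) *
        (∏ i ∈ Finset.univ.filter fun i => h' i = true ∧ h i = false,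
            (b0 ^ (n i - 1) - b1 ^ (n i - 1)) / (Nat.factorial (n i) : ℝ))
      else 0) =
    (Real.exp b0 - Real.exp b1) ^ ((Finset.univ.filter fun i => h i = true).card) *
      ((b1 * Real.exp b0 - b0 * Real.exp b1 + b0 - b1) / (b0 * b1)) ^
        ((Finset.univ.filter fun i => h' i = true).card -
          (Finset.univ.filter fun i => h i = true).card) := by
  set A := Real.exp b0 - Real.exp b1
  set B := (b1 * Real.exp b0 - b0 * Real.exp b1 + b0 - b1) / (b0 * b1)
  let f : Fin N → ℕ → ℝ := fun i n =>
    if h i = true then (b0 ^ n - b1 ^ n) / (n.factorial : ℝ)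
    else if h' i = true then (b0 ^ (n - 1) - b1 ^ (n - 1)) / (n.factorial : ℝ)
    else if n = 0 then 1 else 0
  have hf : ∀ i, HasSum (f i) (if h i = true then A else if h' i = true then B else 1) := by
    intro i
    by_cases hi : h i = true
    · simpa only [f, hi, if_true] using hasSum_pow_sub_pow_div_factorial b0 b1
    by_cases hi' : h' i = true
    · simpa only [f, if_neg hi, if_pos hi'] using
        hasSum_pow_pred_sub_pow_pred_div_factorial hb0.ne' hb1.ne'
    · simpa only [f, if_neg hi, if_neg hi'] using hasSum_ite_eq (0 : ℕ) (1 : ℝ)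
  have hterm : ∀ n : Fin N → ℕ, (if (∀ i, (h i = true → 1 ≤ n i) ∧
      (h' i = true ∧ h i = false → 2 ≤ n i) ∧ (h' i = false → n i = 0)) then
        (∏ i ∈ Finset.univ.filter fun i => h i = true,
            (b0 ^ (n i) - b1 ^ (n i)) / (Nat.factorial (n i) : ℝ)) *
        (∏ i ∈ Finset.univ.filter fun i => h' i = true ∧ h i = false,
            (b0 ^ (n i - 1) - b1 ^ (n i - 1)) / (Nat.factorial (n i) : ℝ))
      else 0) = ∏ i, f i (n i) := by
    intro n
    split_ifs with hn
    · rw [Finset.prod_filter, Finset.prod_filter, ← Finset.prod_mul_distrib]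
      refine Finset.prod_congr rfl fun i _ => ?_
      have h0 := (hn i).2.2
      cases hi : h i <;> cases hi' : h' i <;> simp_all [f]
    · obtain ⟨i, hi⟩ := not_forall.mp hn
      refine (Finset.prod_eq_zero (Finset.mem_univ i) ?_).symm
      have := hle i
      cases hhi : h i <;> cases hhi' : h' i <;> simp_all [f]
  have hcard : (Finset.univ.filter fun i => h' i = true ∧ h i = false).card =
      (Finset.univ.filter fun i => h' i = true).card -
        (Finset.univ.filter fun i => h i = true).card := by
    rw [← Finset.card_sdiff_of_subset (Finset.monotone_filter_right _ fun i _ => hle i)]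
    congr 1
    ext i
    simp
  simp_rw [hterm]
  rw [(hasSum_fin_pi_prod hf).tsum_eq, ← hcard, ← Finset.prod_const, ← Finset.prod_const,
    Finset.prod_filter, Finset.prod_filter, ← Finset.prod_mul_distrib]
  refine Finset.prod_congr rfl fun i _ => ?_
  cases h i <;> cases h' i <;> simp
end

section
/- Let N ≥ 2, fix an index i with 1 ≤ i ≤ N−1, let f_1,…,f_{N−1} ∈ {−1, 1}, fix x_0, x_i ∈ {−1, 1}, and let a and c be real numbers. Then the sum over all (x_l)_{l ∈ {1,…,N−1}\{i}} ∈ {−1,1}^{N−2} of exp( a·[ (Σ_{l=1}^{N−1} x_l·f_l)² + 2c·x_0·(Σ_{l=1}^{N−1} x_l·f_l) ] ) equals e^{a·(1 + 2c·x_0·x_i·f_i)} · Σ_{k=0}^{N−2} C(N−2, k) · e^{a·(2k+2−N)²} · e^{2a·(2k+2−N)·(x_i·f_i + c·x_0)}. -/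
/-- Summing a function of a sum of signs over all sign patterns: fixed signs `g l = ±1` can be
absorbed into the pattern, and there are `C(n, k)` patterns with exactly `k` positive terms. -/
theorem sum_apply_signed_sum_eq_sum_choose {ι M : Type*} [Fintype ι] [DecidableEq ι]
    [AddCommMonoid M] (g : ι → ℝ) (hg : ∀ l, g l = 1 ∨ g l = -1) (F : ℝ → M) :
    ∑ x : ι → Bool, F (∑ l, (if x l then (1 : ℝ) else -1) * g l) =
      ∑ k ∈ Finset.range (Fintype.card ι + 1),
        (Fintype.card ι).choose k • F (2 * (k : ℝ) - Fintype.card ι) := by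
  have hcount := Finset.sum_powerset_apply_card
    (fun k : ℕ => F (2 * (k : ℝ) - Fintype.card ι)) (x := (Finset.univ : Finset ι))
  rw [Finset.card_univ] at hcount
  rw [← hcount, Finset.powerset_univ]
  refine Finset.sum_bij' (fun x _ => Finset.univ.filter fun l => (x l = true ↔ g l = 1))
    (fun s _ l => decide (l ∈ s ↔ g l = 1)) (by simp) (by simp) ?_ ?_ ?_
  · intro x _
    funext l
    by_cases h : g l = 1 <;> simp [h]
  · intro s _
    ext l
    by_cases h : g l = 1 <;> simp [h]
  · intro x _
    have hterm : ∀ l, (if x l then (1 : ℝ) else -1) * g l =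
        2 * (if (x l = true ↔ g l = 1) then 1 else 0) - 1 := by
      intro l
      rcases hg l with h | h <;> cases x l <;> norm_num [h]
    simp only [hterm, Finset.sum_sub_distrib, ← Finset.mul_sum, Finset.sum_boole]
    simp


/-- Partial sum over the key-generation signs of all parties except `A_0` and `A_i`
(the remaining signs encoded as `x : {l // l ≠ i} → Bool`, `true ↦ 1`, `false ↦ -1`):
`∑_{(x_l)_{l≠i}} exp(a[(∑_{l≥1} x_l f_l)² + 2c x_0 (∑_{l≥1} x_l f_l)])
  = e^{a(1+2c x_0 x_i f_i)} ∑_{k=0}^{N-2} C(N-2,k) e^{a(2k+2-N)²}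
      e^{2a(2k+2-N)(x_i f_i + c x_0)}`. -/
theorem partial_sum_over_signs_qber (N : ℕ) (hN : 2 ≤ N) (i : Fin (N - 1))
    (f : Fin (N - 1) → ℝ) (hf : ∀ l, f l = 1 ∨ f l = -1)
    (x0 xi : ℝ) (hx0 : x0 = 1 ∨ x0 = -1) (hxi : xi = 1 ∨ xi = -1) (a c : ℝ) :
    (∑ x : {l : Fin (N - 1) // l ≠ i} → Bool,
      Real.exp (a *
        ((xi * f i + ∑ l : {l : Fin (N - 1) // l ≠ i},
            (if x l then (1 : ℝ) else -1) * f (l : Fin (N - 1))) ^ 2 +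
          2 * c * x0 *
            (xi * f i + ∑ l : {l : Fin (N - 1) // l ≠ i},
              (if x l then (1 : ℝ) else -1) * f (l : Fin (N - 1)))))) =
      Real.exp (a * (1 + 2 * c * x0 * xi * f i)) *
        ∑ k ∈ Finset.range (N - 1),
          (Nat.choose (N - 2) k : ℝ) * Real.exp (a * (2 * (k : ℝ) + 2 - N) ^ 2) *
            Real.exp (2 * a * (2 * (k : ℝ) + 2 - N) * (xi * f i + c * x0)) := by
  obtain ⟨n, rfl⟩ := Nat.exists_eq_add_of_le' hN
  have hcard : Fintype.card {l : Fin (n + 2 - 1) // l ≠ i} = n := by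
    simp [Fintype.card_subtype_compl]
  have hsq : (xi * f i) ^ 2 = 1 := by
    rcases hxi with rfl | rfl <;> rcases hf i with h | h <;> norm_num [h]
  rw [sum_apply_signed_sum_eq_sum_choose (fun l : {l : Fin (n + 2 - 1) // l ≠ i} => f l)
    (fun l => hf l)
    (fun S => Real.exp (a * ((xi * f i + S) ^ 2 + 2 * c * x0 * (xi * f i + S)))),
    hcard, Finset.mul_sum]
  refine Finset.sum_congr rfl fun k _ => ?_
  rw [nsmul_eq_mul, Nat.add_sub_cancel, mul_assoc (n.choose k : ℝ),
    mul_left_comm (Real.exp _) (n.choose k : ℝ), ← Real.exp_add, ← Real.exp_add]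
  congr 2
  push_cast
  linear_combination a * hsq
end

section
/- Let s ≥ 1, M = 2^s, 1 ≤ N ≤ M, let η and θ be real numbers, let β_0,…,β_{N−1} ≥ 0, and let 0 ≤ j < M. Define F_j : ℝ^N → ℝ by F_j(φ_0,…,φ_{N−1}) = exp[ (2η/M)·( cos θ · Σ_{i=1}^{N−1} (−1)^{\vec i·\vec j} · √(β_0·β_i) · cos(φ_0 − φ_i) + Σ_{1 ≤ i < i' ≤ N−1} (−1)^{(\vec i + \vec i')·\vec j} · √(β_i·β_{i'}) · cos(φ_i − φ_{i'}) ) ]. Then ∫_{[0,2π]^N} F_j(φ) dφ = ∫_{[0,2π]^N} F_0(φ) dφ. -/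
open MeasureTheory

/-- The integrand `F_j` of the gain `I_j(β_0,…,β_{N-1})` of the protocol when
detector `D_j` clicks (with `M = 2^s` detectors). -/
noncomputable def Fgain (s N : ℕ) [NeZero N] (η θ : ℝ) (β : Fin N → ℝ) (j : ℕ)
    (φ : Fin N → ℝ) : ℝ :=
  Real.exp ((2 * η / (2 ^ s : ℝ)) *
    (Real.cos θ *
        ∑ i ∈ Finset.univ.filter (fun i : Fin N => (i : ℕ) ≠ 0),
          (-1 : ℝ) ^ (bitDot s (i : ℕ) j) * Real.sqrt (β 0 * β i) *
            Real.cos (φ 0 - φ i) +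
      ∑ i ∈ Finset.univ.filter (fun i : Fin N => (i : ℕ) ≠ 0),
        ∑ i' ∈ Finset.univ.filter (fun i' : Fin N => i < i'),
          (-1 : ℝ) ^ (∑ l ∈ Finset.range s,
              ((i : ℕ) / 2 ^ l % 2 + (i' : ℕ) / 2 ^ l % 2) * (j / 2 ^ l % 2)) *
            Real.sqrt (β i * β i') * Real.cos (φ i - φ i')))

/-- The integral over the cube `[0,T]^ι` of a function that is `T`-periodic in every coordinate
is invariant under translations. -/
theorem setIntegral_pi_Icc_comp_coe_add {ι E : Type*} [Fintype ι] [NormedAddCommGroup E]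
    [NormedSpace ℝ E] {T : ℝ} [Fact (0 < T)] {G : (ι → AddCircle T) → E} (hG : Continuous G)
    (a : ι → ℝ) :
    (∫ φ in Set.univ.pi fun _ : ι => Set.Icc (0 : ℝ) T,
        G fun i => ((φ i + a i : ℝ) : AddCircle T)) =
      ∫ φ in Set.univ.pi fun _ : ι => Set.Icc (0 : ℝ) T, G fun i => (φ i : AddCircle T) := by
  have hmp : MeasurePreserving (fun (φ : ι → ℝ) i => (φ i : AddCircle T))
      (volume.restrict (Set.univ.pi fun _ : ι => Set.Icc (0 : ℝ) T)) volume := by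
    rw [volume_pi, Measure.restrict_pi_pi, volume_pi]
    refine measurePreserving_pi _ _ fun _ => ?_
    rw [← Measure.restrict_congr_set Ioc_ae_eq_Icc]
    simpa using AddCircle.measurePreserving_mk T 0
  have key : ∀ H : (ι → AddCircle T) → E, Continuous H →
      (∫ φ in Set.univ.pi fun _ : ι => Set.Icc (0 : ℝ) T, H fun i => (φ i : AddCircle T)) =
        ∫ x, H x := fun H hH => by
    rw [← hmp.map_eq, integral_map hmp.aemeasurable]
    rw [hmp.map_eq]
    exact hH.aestronglyMeasurable
  rw [key G hG, ← integral_add_right_eq_self G fun i => (a i : AddCircle T)]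
  exact key (fun x => G (x + fun i => (a i : AddCircle T))) (by fun_prop)

theorem bitDot_zero_left (s j : ℕ) : bitDot s 0 j = 0 := by
  simp [bitDot]

theorem bitDot_zero_right (s i : ℕ) : bitDot s i 0 = 0 := by
  simp [bitDot]

theorem sum_bits_add_mul_eq_bitDot_add (s i i' j : ℕ) :
    ∑ l ∈ Finset.range s, (i / 2 ^ l % 2 + i' / 2 ^ l % 2) * (j / 2 ^ l % 2) =
      bitDot s i j + bitDot s i' j := by
  simp [bitDot, add_mul, Finset.sum_add_distrib]

theorem cos_add_nat_mul_pi_sub_add_nat_mul_pi (x y : ℝ) (m n : ℕ) :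
    Real.cos (x + m * Real.pi - (y + n * Real.pi)) = (-1) ^ (m + n) * Real.cos (x - y) := by
  rw [show x + m * Real.pi - (y + n * Real.pi) = x - y + m * Real.pi - n * Real.pi by ring,
    Real.cos_sub_nat_mul_pi, Real.cos_add_nat_mul_pi, pow_add]
  ring

/-- Shifting each phase `φ i` by `π` times the dot product of `i` and `j` turns the integrand
for detector `0` into the integrand for detector `j`. -/
theorem Fgain_zero_add_bitDot_mul_pi (s N : ℕ) [NeZero N] (η θ : ℝ) (β : Fin N → ℝ) (j : ℕ)
    (φ : Fin N → ℝ) :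
    Fgain s N η θ β 0 (fun i => φ i + bitDot s i j * Real.pi) = Fgain s N η θ β j φ := by
  simp only [Fgain, sum_bits_add_mul_eq_bitDot_add, bitDot_zero_right,
    cos_add_nat_mul_pi_sub_add_nat_mul_pi, Fin.val_zero, bitDot_zero_left, zero_add, add_zero,
    pow_zero, one_mul, mul_assoc, mul_left_comm]

/-- The integrand of the gain is a continuous function of the phases modulo `2π`. -/
theorem exists_continuous_Fgain_eq (s N : ℕ) [NeZero N] (η θ : ℝ) (β : Fin N → ℝ) (j : ℕ) :
    ∃ G : (Fin N → AddCircle (2 * Real.pi)) → ℝ, Continuous G ∧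
      ∀ φ : Fin N → ℝ, Fgain s N η θ β j φ = G fun i => (φ i : AddCircle (2 * Real.pi)) := by
  obtain ⟨c, hc, hcos⟩ : ∃ c : AddCircle (2 * Real.pi) → ℝ, Continuous c ∧
      ∀ x : ℝ, c x = Real.cos x :=
    ⟨Real.Angle.cos, Real.Angle.continuous_cos, Real.Angle.cos_coe⟩
  refine ⟨fun x => Real.exp ((2 * η / (2 ^ s : ℝ)) *
    (Real.cos θ *
        ∑ i ∈ Finset.univ.filter (fun i : Fin N => (i : ℕ) ≠ 0),
          (-1 : ℝ) ^ (bitDot s (i : ℕ) j) * Real.sqrt (β 0 * β i) * c (x 0 - x i) +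
      ∑ i ∈ Finset.univ.filter (fun i : Fin N => (i : ℕ) ≠ 0),
        ∑ i' ∈ Finset.univ.filter (fun i' : Fin N => i < i'),
          (-1 : ℝ) ^ (∑ l ∈ Finset.range s,
              ((i : ℕ) / 2 ^ l % 2 + (i' : ℕ) / 2 ^ l % 2) * (j / 2 ^ l % 2)) *
            Real.sqrt (β i * β i') * c (x i - x i'))), by fun_prop, fun φ => ?_⟩
  simp only [Fgain, ← AddCircle.coe_sub, hcos]

/-- The gains are independent of which detector clicks:
`∫_{[0,2π]^N} F_j(φ) dφ = ∫_{[0,2π]^N} F_0(φ) dφ`. -/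
theorem gain_integral_detector_independent (s N : ℕ) [NeZero N] (hs : 1 ≤ s)
    (hN : N ≤ 2 ^ s) (η θ : ℝ) (β : Fin N → ℝ) (hβ : ∀ i, 0 ≤ β i)
    (j : ℕ) (hj : j < 2 ^ s) :
    (∫ φ in Set.univ.pi fun _ : Fin N => Set.Icc (0 : ℝ) (2 * Real.pi),
        Fgain s N η θ β j φ) =
      ∫ φ in Set.univ.pi fun _ : Fin N => Set.Icc (0 : ℝ) (2 * Real.pi),
        Fgain s N η θ β 0 φ := by
  obtain ⟨G, hG, hFG⟩ := exists_continuous_Fgain_eq s N η θ β 0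
  have : Fact (0 < 2 * Real.pi) := ⟨Real.two_pi_pos⟩
  simp only [← Fgain_zero_add_bitDot_mul_pi s N η θ β j, hFG]
  exact setIntegral_pi_Icc_comp_coe_add hG _
end
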